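/- arXiv:2311.13528 — 7 statements merged into one kernel-verified Lean document; each statement's English description precedes it below -/
import Mathlib

section
/- Let H be a 2-dimensional complex inner product space and let {Π_{0|0}, Π_{1|0}} and {Π_{0|1}, Π_{1|1}} be two rank-one projective measurements on H (for each j ∈ {0,1}, Π_{0|j} and Π_{1|j} are orthogonal projections of rank one with Π_{0|j} + Π_{1|j} = id). Then there exists a unitary operator U on H such that U Π_{j|i} U* = Π_{j⊕1|i} for all i, j ∈ {0,1}, where ⊕ is addition modulo 2. -/
open scoped InnerProductSpace ComplexConjugate

section

variable {H : Type*} [NormedAddCommGroup H] [InnerProductSpace ℂ H]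

/-- In dimension two, a unitary exchanging two orthonormal vectors up to the phase `u`
intertwines an operator `Q` of trace one with `1 - Q`, provided that `u` matches the
off-diagonal entries of `Q`. -/
theorem OrthonormalBasis.swap_phase_intertwines (b : OrthonormalBasis (Fin 2) ℂ H)
    {Q : H →ₗ[ℂ] H} (htr : LinearMap.trace ℂ H Q = 1) {u : ℂ}
    (hu : u * ⟪b 1, Q (b 0)⟫_ℂ = -⟪b 0, Q (b 1)⟫_ℂ) {U : H →ₗ[ℂ] H}
    (h0 : U (b 0) = b 1) (h1 : U (b 1) = u • b 0) (x : H) :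
    U (Q x) = U x - Q (U x) := by
  have hexp (y : H) : y = ⟪b 0, y⟫_ℂ • b 0 + ⟪b 1, y⟫_ℂ • b 1 := by
    simpa using (b.sum_repr' y).symm
  have htr' : ⟪b 0, Q (b 0)⟫_ℂ + ⟪b 1, Q (b 1)⟫_ℂ = 1 := by
    rw [← htr, Q.trace_eq_sum_inner b, Fin.sum_univ_two]
  have hQ0 := hexp (Q (b 0))
  have hQ1 := hexp (Q (b 1))
  generalize ⟪b 0, Q (b 0)⟫_ℂ = a at *
  generalize ⟪b 1, Q (b 0)⟫_ℂ = c at *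
  generalize ⟪b 0, Q (b 1)⟫_ℂ = β at *
  generalize ⟪b 1, Q (b 1)⟫_ℂ = d at *
  obtain rfl : a = 1 - d := by linear_combination htr'
  obtain rfl : β = -(u * c) := by linear_combination hu
  rw [hexp x]
  simp only [map_add, map_smul, h0, h1, hQ0, hQ1]
  module

/-- Every complex number is turned into minus its conjugate by some phase. -/
theorem Complex.exists_norm_one_mul_eq_neg_conj (c : ℂ) :
    ∃ u : ℂ, ‖u‖ = 1 ∧ u * c = -conj c := by
  rcases eq_or_ne c 0 with rfl | hc
  · exact ⟨1, by simp⟩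
  · exact ⟨-conj c / c, by simp [hc], by field_simp⟩

/-- Two idempotents of rank one that sum to the identity and are symmetric have ranges spanned
by the members of an orthonormal basis. -/
theorem exists_orthonormalBasis_of_rank_one_symmetric [FiniteDimensional ℂ H]
    (hdim : Module.finrank ℂ H = 2) {P Q : H →ₗ[ℂ] H} (hP : P.IsSymmetric)
    (hPidem : P ∘ₗ P = P) (hQidem : Q ∘ₗ Q = Q)
    (hPrank : Module.finrank ℂ (LinearMap.range P) = 1)
    (hQrank : Module.finrank ℂ (LinearMap.range Q) = 1) (hsum : P + Q = LinearMap.id) :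
    ∃ b : OrthonormalBasis (Fin 2) ℂ H, P (b 0) = b 0 ∧ P (b 1) = 0 := by
  have key {T : H →ₗ[ℂ] H} (hT : T ∘ₗ T = T)
      (hr : Module.finrank ℂ (LinearMap.range T) = 1) : ∃ e : H, ‖e‖ = 1 ∧ T e = e := by
    have : Nontrivial (LinearMap.range T) := Module.nontrivial_of_finrank_pos (R := ℂ) (by omega)
    obtain ⟨⟨_, y, rfl⟩, he⟩ := exists_norm_eq (LinearMap.range T) zero_le_one
    exact ⟨T y, he, LinearMap.congr_fun hT y⟩
  obtain ⟨e, he, hPe⟩ := key hPidem hPrank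
  obtain ⟨f, hf, hQf⟩ := key hQidem hQrank
  have hPf : P f = 0 := by simpa [hQf] using LinearMap.congr_fun hsum f
  have hef : ⟪e, f⟫_ℂ = 0 := by rw [← hPe, hP, hPf, inner_zero_right]
  have hon : Orthonormal ℂ ![e, f] := by simp [orthonormal_vecCons_iff, he, hf, hef]
  have hspan : ⊤ ≤ Submodule.span ℂ (Set.range ![e, f]) :=
    (hon.linearIndependent.span_eq_top_of_card_eq_finrank (by simp [hdim])).ge
  exact ⟨OrthonormalBasis.mk hon hspan, by simp [hPe], by simp [hPf]⟩

/-- A unitary exchanging the members of an orthonormal basis of a plane, up to a phase. -/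
theorem OrthonormalBasis.exists_swap_phase (b : OrthonormalBasis (Fin 2) ℂ H)
    {u : ℂ} (hu : ‖u‖ = 1) : ∃ U : H ≃ₗᵢ[ℂ] H, U (b 0) = b 1 ∧ U (b 1) = u • b 0 := by
  have hon : Orthonormal ℂ ![b 1, u • b 0] := by
    simp [orthonormal_vecCons_iff, norm_smul, hu, inner_smul_right]
  have := b.toBasis.finiteDimensional_of_finite
  have hspan : ⊤ ≤ Submodule.span ℂ (Set.range ![b 1, u • b 0]) :=
    (hon.linearIndependent.span_eq_top_of_card_eq_finrank
      (Module.finrank_eq_card_basis b.toBasis).symm).ge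
  refine ⟨b.equiv (OrthonormalBasis.mk hon hspan) (Equiv.refl _), ?_, ?_⟩ <;> simp

end


/-- Given two rank-one projective measurements `{P 0 i, P 1 i}` (i = 0,1) on a
2-dimensional complex inner product space, there is a unitary `U` with
`U (P j i) U⁻¹ = P (j ⊕ 1) i` for all `i, j`. -/
theorem unitary_swapping_projectors (H : Type*) [NormedAddCommGroup H]
    [InnerProductSpace ℂ H] [FiniteDimensional ℂ H]
    (hdim : Module.finrank ℂ H = 2)
    (P : Fin 2 → Fin 2 → (H →ₗ[ℂ] H))
    (hsym : ∀ i j, LinearMap.IsSymmetric (P i j))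
    (hidem : ∀ i j, P i j ∘ₗ P i j = P i j)
    (hrank : ∀ i j, Module.finrank ℂ (LinearMap.range (P i j)) = 1)
    (hsum : ∀ j, P 0 j + P 1 j = LinearMap.id) :
    ∃ U : H ≃ₗᵢ[ℂ] H,
      ∀ i j : Fin 2,
        U.toLinearMap ∘ₗ P j i ∘ₗ U.symm.toLinearMap = P (j + 1) i := by
  obtain ⟨b, hb0, hb1⟩ := exists_orthonormalBasis_of_rank_one_symmetric hdim (hsym 0 0)
    (hidem 0 0) (hidem 1 0) (hrank 0 0) (hrank 1 0) (hsum 0)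
  obtain ⟨u, hu, huc⟩ := Complex.exists_norm_one_mul_eq_neg_conj ⟪b 1, P 0 1 (b 0)⟫_ℂ
  obtain ⟨U, hU0, hU1⟩ := b.exists_swap_phase hu
  have htr (i : Fin 2) : LinearMap.trace ℂ H (P 0 i) = 1 := by
    have h : IsIdempotentElem (P 0 i) := hidem 0 i
    rw [(LinearMap.isProj_range_iff_isIdempotentElem _).2 h |>.trace, hrank, Nat.cast_one]
  have hoff (i : Fin 2) : u * ⟪b 1, P 0 i (b 0)⟫_ℂ = -⟪b 0, P 0 i (b 1)⟫_ℂ := by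
    fin_cases i
    · simp [hb0, hb1]
    · simpa [hsym 0 1 (b 0) (b 1)] using huc
  have hP1 (i : Fin 2) (x : H) : P 1 i x = x - P 0 i x :=
    eq_sub_of_add_eq' (LinearMap.congr_fun (hsum i) x)
  have hswap (i : Fin 2) (x : H) : U (P 0 i x) = U x - P 0 i (U x) :=
    b.swap_phase_intertwines (htr i) (hoff i) (U := U.toLinearMap) hU0 hU1 x
  refine ⟨U, fun i j => LinearMap.ext fun x => ?_⟩
  fin_cases j
  · simp [hswap, hP1]
  · simp [hswap, hP1]
end

section
/- Fix R ∈ (1/√2, 1] and θ ∈ [0, π/4 − arccos(1/(√2·R))]. Set δ* = (R²·cos(2θ))/4. Then δ* lies in the interval [−1/4 + (R cos θ)/2, 1/4 − (R sin θ)/2], and the function δ ↦ H(λ₀(δ), λ₁(δ), λ₂(δ), λ₃(δ)), defined on this interval, attains its maximum at δ = δ*, where λ₀(δ) = 1/4 + (R cos θ)/2 + δ, λ₁(δ) = 1/4 + (R sin θ)/2 − δ, λ₂(δ) = 1/4 − (R sin θ)/2 − δ, λ₃(δ) = 1/4 − (R cos θ)/2 + δ. -/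
open Real

/-- `ent x = -x·log₂ x`, with the convention `0·log₂ 0 = 0`
(automatic, since `Real.logb 2 0 = 0`). -/
noncomputable def ent (x : ℝ) : ℝ := -(x * Real.logb 2 x)

/-- Shannon entropy (base 2) of a probability vector of length 4. -/
noncomputable def H4 (a b c d : ℝ) : ℝ := ent a + ent b + ent c + ent d

/-- The pointwise form of Gibbs' inequality. -/
lemma ent_le_tangent {a b : ℝ} (ha : 0 ≤ a) (hb : 0 < b) :
    ent a ≤ (-(a * Real.log b) + (b - a)) / Real.log 2 := by
  have h2 : 0 < Real.log 2 := Real.log_pos one_lt_two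
  unfold ent Real.logb
  rw [le_div_iff₀ h2]
  have e : -(a * (Real.log a / Real.log 2)) * Real.log 2 = -(a * Real.log a) := by
    field_simp
  rw [e]
  rcases ha.eq_or_lt with rfl | ha
  · simpa using hb.le
  · have h := Real.log_le_sub_one_of_pos (div_pos hb ha)
    rw [Real.log_div hb.ne' ha.ne'] at h
    have h' := mul_le_mul_of_nonneg_left h ha.le
    have e' : a * (b / a - 1) = b - a := by field_simp
    linarith

/-- Among distributions on `{0, 1}²` with fixed marginals, the product distribution with
positive weights maximizes the entropy. -/
lemma H4_le_of_mul_eq_mul {a b c d t : ℝ} (ha : 0 < a) (hb : 0 < b) (hc : 0 < c) (hd : 0 < d)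
    (h : a * d = b * c) (ha' : 0 ≤ a + t) (hb' : 0 ≤ b - t) (hc' : 0 ≤ c - t)
    (hd' : 0 ≤ d + t) :
    H4 (a + t) (b - t) (c - t) (d + t) ≤ H4 a b c d := by
  have hlog : Real.log a + Real.log d = Real.log b + Real.log c := by
    rw [← Real.log_mul ha.ne' hd.ne', ← Real.log_mul hb.ne' hc.ne', h]
  have key : (-((a + t) * Real.log a) + (a - (a + t))) / Real.log 2
      + (-((b - t) * Real.log b) + (b - (b - t))) / Real.log 2
      + (-((c - t) * Real.log c) + (c - (c - t))) / Real.log 2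
      + (-((d + t) * Real.log d) + (d - (d + t))) / Real.log 2 = H4 a b c d := by
    unfold H4 ent Real.logb
    linear_combination (-t / Real.log 2) * hlog
  rw [← key]
  unfold H4
  linarith [ent_le_tangent ha' ha, ent_le_tangent hb' hb, ent_le_tangent hc' hc,
    ent_le_tangent hd' hd]

/-- The admissible angles keep the point with polar coordinates `(R, θ)` in the simplex
`x + y ≤ 1`. -/
lemma mul_cos_add_mul_sin_le_one {R θ : ℝ} (hR : 1 / Real.sqrt 2 < R) (hθ0 : 0 ≤ θ)
    (hθ1 : θ ≤ π / 4 - Real.arccos (1 / (Real.sqrt 2 * R))) :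
    R * Real.cos θ + R * Real.sin θ ≤ 1 := by
  have hs : 0 < Real.sqrt 2 := by positivity
  have hR0 : 0 < R := lt_trans (by positivity) hR
  have hle : 1 / (Real.sqrt 2 * R) ≤ 1 := by
    rw [div_lt_iff₀ hs] at hR
    rw [div_le_one (by positivity)]
    linarith
  have hc : Real.cos (π / 4 - θ) ≤ 1 / (Real.sqrt 2 * R) := by
    rw [← Real.cos_arccos (x := 1 / (Real.sqrt 2 * R))
      (le_trans (by norm_num) (show (0 : ℝ) ≤ 1 / (Real.sqrt 2 * R) by positivity)) hle]
    exact Real.cos_le_cos_of_nonneg_of_le_pi (Real.arccos_nonneg _)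
      (by linarith [Real.pi_pos]) (by linarith)
  rw [Real.cos_sub, Real.cos_pi_div_four, Real.sin_pi_div_four,
    le_div_iff₀ (by positivity)] at hc
  have hsq : Real.sqrt 2 * Real.sqrt 2 = 2 := Real.mul_self_sqrt (by norm_num)
  linear_combination hc - (R * Real.cos θ + R * Real.sin θ) / 2 * hsq

/-- For `R ∈ (1/√2, 1]` and admissible `θ`, the value `δ* = R²·cos(2θ)/4` lies in the
valid range of `δ`, and the entropy of the Bell-diagonal eigenvalues
`λᵢ(δ)` attains its maximum over that range at `δ = δ*`. -/
theorem delta_star_maximizes_entropy (R θ : ℝ)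
    (hR : 1 / Real.sqrt 2 < R) (hR1 : R ≤ 1)
    (hθ0 : 0 ≤ θ) (hθ1 : θ ≤ π / 4 - Real.arccos (1 / (Real.sqrt 2 * R))) :
    (-(1 / 4) + R * Real.cos θ / 2 ≤ R ^ 2 * Real.cos (2 * θ) / 4 ∧
      R ^ 2 * Real.cos (2 * θ) / 4 ≤ 1 / 4 - R * Real.sin θ / 2) ∧
    (∀ δ : ℝ, -(1 / 4) + R * Real.cos θ / 2 ≤ δ → δ ≤ 1 / 4 - R * Real.sin θ / 2 →
      H4 (1 / 4 + R * Real.cos θ / 2 + δ) (1 / 4 + R * Real.sin θ / 2 - δ)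
         (1 / 4 - R * Real.sin θ / 2 - δ) (1 / 4 - R * Real.cos θ / 2 + δ) ≤
      H4 (1 / 4 + R * Real.cos θ / 2 + R ^ 2 * Real.cos (2 * θ) / 4)
         (1 / 4 + R * Real.sin θ / 2 - R ^ 2 * Real.cos (2 * θ) / 4)
         (1 / 4 - R * Real.sin θ / 2 - R ^ 2 * Real.cos (2 * θ) / 4)
         (1 / 4 - R * Real.cos θ / 2 + R ^ 2 * Real.cos (2 * θ) / 4)) := by
  have hR0 : 0 < R := lt_trans (by positivity) hR
  have hxy := mul_cos_add_mul_sin_le_one hR hθ0 hθ1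
  have hθ : θ ≤ π / 4 := hθ1.trans (sub_le_self _ (Real.arccos_nonneg _))
  have hx : 0 ≤ R * Real.cos θ := mul_nonneg hR0.le
    (Real.cos_nonneg_of_neg_pi_div_two_le_of_le (by linarith [Real.pi_pos])
      (by linarith [Real.pi_pos]))
  have hy : 0 ≤ R * Real.sin θ := mul_nonneg hR0.le
    (Real.sin_nonneg_of_nonneg_of_le_pi hθ0 (by linarith [Real.pi_pos]))
  have hδ : R ^ 2 * Real.cos (2 * θ) = (R * Real.cos θ) ^ 2 - (R * Real.sin θ) ^ 2 := by
    rw [Real.cos_two_mul']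
    ring
  rw [hδ]
  generalize R * Real.cos θ = x at *
  generalize R * Real.sin θ = y at *
  have hl : -(1 / 4) + x / 2 ≤ (x ^ 2 - y ^ 2) / 4 := by
    nlinarith [mul_nonneg (sub_nonneg.2 hxy) (show 0 ≤ 1 - x + y by linarith)]
  have hu : (x ^ 2 - y ^ 2) / 4 ≤ 1 / 4 - y / 2 := by
    nlinarith [mul_nonneg (sub_nonneg.2 hxy) (show 0 ≤ 1 + x - y by linarith)]
  refine ⟨⟨hl, hu⟩, fun δ h1 h2 => ?_⟩
  rcases hxy.eq_or_lt with hxy | hxy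
  · have : δ = (x ^ 2 - y ^ 2) / 4 := by linarith
    rw [this]
  · have p1 : 0 < 1 + x + y := by linarith
    have p2 : 0 < 1 + x - y := by linarith
    have p3 : 0 < 1 - x + y := by linarith
    have p4 : 0 < 1 - x - y := by linarith
    have h := H4_le_of_mul_eq_mul (a := 1 / 4 + x / 2 + (x ^ 2 - y ^ 2) / 4)
      (b := 1 / 4 + y / 2 - (x ^ 2 - y ^ 2) / 4) (c := 1 / 4 - y / 2 - (x ^ 2 - y ^ 2) / 4)
      (d := 1 / 4 - x / 2 + (x ^ 2 - y ^ 2) / 4) (t := δ - (x ^ 2 - y ^ 2) / 4)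
      (by linarith [mul_pos p1 p2]) (by linarith [mul_pos p1 p3])
      (by linarith [mul_pos p4 p2]) (by linarith [mul_pos p4 p3]) (by ring)
      (by linarith) (by linarith) (by linarith) (by linarith)
    convert h using 2 <;> ring
end

section
/- For all R ∈ [0,1], θ ∈ [0, π/4] and α₀, α₁, β₀, β₁ ∈ ℝ, the CHSH score satisfies S(R, θ, α₀, α₁, β₀, β₁) ≤ 1/2 + R/(2√2). Moreover, equality is achieved for the choice α₀ = 0, α₁ = π/4, β₀ = π/8 − θ/2, β₁ = −π/8 + θ/2. -/
open Real

noncomputable def eps00 (R θ a0 a1 b0 b1 : ℝ) : ℝ :=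
  (1 + R * Real.cos θ * Real.cos (2 * (a0 - b0))
     + R * Real.sin θ * Real.cos (2 * (a0 + b0))) / 4

noncomputable def eps01 (R θ a0 a1 b0 b1 : ℝ) : ℝ :=
  (1 + R * Real.cos θ * Real.cos (2 * (a0 - b1))
     + R * Real.sin θ * Real.cos (2 * (a0 + b1))) / 4

noncomputable def eps10 (R θ a0 a1 b0 b1 : ℝ) : ℝ :=
  (1 + R * Real.cos θ * Real.cos (2 * (a1 - b0))
     + R * Real.sin θ * Real.cos (2 * (a1 + b0))) / 4

noncomputable def eps11 (R θ a0 a1 b0 b1 : ℝ) : ℝ :=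
  (1 - R * Real.cos θ * Real.cos (2 * (a1 - b1))
     - R * Real.sin θ * Real.cos (2 * (a1 + b1))) / 4

/-- The CHSH score of the qubit strategy with parameters `R, θ, α₀, α₁, β₀, β₁`. -/
noncomputable def chshS (R θ a0 a1 b0 b1 : ℝ) : ℝ :=
  (eps00 R θ a0 a1 b0 b1 + eps01 R θ a0 a1 b0 b1
    + eps10 R θ a0 a1 b0 b1 + eps11 R θ a0 a1 b0 b1) / 2

/-- The Cauchy–Schwarz inequality in the plane against a unit vector `(x, y)`. -/
theorem sq_mul_add_mul_le_of_unit {x y : ℝ} (h : x ^ 2 + y ^ 2 = 1) (u v : ℝ) :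
    (x * u + y * v) ^ 2 ≤ u ^ 2 + v ^ 2 := by
  have key : u ^ 2 + v ^ 2 = (x * u + y * v) ^ 2 + (x * v - y * u) ^ 2 := by
    linear_combination -(u ^ 2 + v ^ 2) * h
  nlinarith [sq_nonneg (x * v - y * u)]

/-- The Tsirelson-type bound underlying the CHSH score, in terms of the half-sum `σ` and
half-difference `δ` of the two angles of the second party. -/
theorem tsirelson_bound (p q a a' σ δ : ℝ) (h : p ^ 2 + q ^ 2 = 2) :
    cos δ * (cos a * (p * cos σ) + sin a * (q * sin σ))
      + sin δ * (cos a' * (-p * sin σ) + sin a' * (q * cos σ)) ≤ √2 := by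
  apply Real.le_sqrt_of_sq_le
  refine (sq_mul_add_mul_le_of_unit (cos_sq_add_sin_sq δ) _ _).trans ?_
  have h1 := sq_mul_add_mul_le_of_unit (cos_sq_add_sin_sq a) (p * cos σ) (q * sin σ)
  have h2 := sq_mul_add_mul_le_of_unit (cos_sq_add_sin_sq a') (-p * sin σ) (q * cos σ)
  have h3 : (p * cos σ) ^ 2 + (q * sin σ) ^ 2 + ((-p * sin σ) ^ 2 + (q * cos σ) ^ 2) = 2 := by
    linear_combination (p ^ 2 + q ^ 2) * cos_sq_add_sin_sq σ + h
  linarith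

/-- The CHSH score in terms of the sum and difference of the angles of the second party. -/
theorem chshS_eq (R θ a0 a1 b0 b1 : ℝ) :
    chshS R θ a0 a1 b0 b1 = 1 / 2 + R / 4 *
      (cos (b0 - b1) * (cos (2 * a0) * ((cos θ + sin θ) * cos (b0 + b1))
          + sin (2 * a0) * ((cos θ - sin θ) * sin (b0 + b1)))
        + sin (b0 - b1) * (cos (2 * a1) * (-(cos θ + sin θ) * sin (b0 + b1))
          + sin (2 * a1) * ((cos θ - sin θ) * cos (b0 + b1)))) := by
  obtain ⟨σ, hσ⟩ : ∃ σ, σ = b0 + b1 := ⟨_, rfl⟩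
  obtain ⟨δ, hδ⟩ : ∃ δ, δ = b0 - b1 := ⟨_, rfl⟩
  obtain rfl : b0 = (σ + δ) / 2 := by linarith
  obtain rfl : b1 = (σ - δ) / 2 := by linarith
  rw [← hσ, ← hδ]
  simp only [chshS, eps00, eps01, eps10, eps11, mul_sub, mul_add, mul_div_cancel₀, ne_eq,
    OfNat.ofNat_ne_zero, not_false_eq_true, cos_add, cos_sub, sin_add, sin_sub]
  ring

/-- The CHSH score is at most `1/2 + R/(2√2)`, with equality for the choice
`α₀ = 0, α₁ = π/4, β₀ = π/8 - θ/2, β₁ = -π/8 + θ/2`. -/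
theorem chsh_score_bound (R θ : ℝ) (hR0 : 0 ≤ R) (hR1 : R ≤ 1)
    (hθ0 : 0 ≤ θ) (hθ1 : θ ≤ π / 4) :
    (∀ a0 a1 b0 b1 : ℝ,
      chshS R θ a0 a1 b0 b1 ≤ 1 / 2 + R / (2 * Real.sqrt 2)) ∧
    chshS R θ 0 (π / 4) (π / 8 - θ / 2) (-(π / 8) + θ / 2)
      = 1 / 2 + R / (2 * Real.sqrt 2) := by
  have hR : R / (2 * √2) = R / 4 * √2 := by
    have h2 : √2 ^ 2 = 2 := Real.sq_sqrt (by norm_num)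
    have h0 : √2 ≠ 0 := by positivity
    field_simp
    rw [h2]
    ring
  have hpq : (cos θ + sin θ) ^ 2 + (cos θ - sin θ) ^ 2 = 2 := by
    linear_combination 2 * cos_sq_add_sin_sq θ
  constructor
  · intro a0 a1 b0 b1
    rw [chshS_eq, hR]
    gcongr
    exact tsirelson_bound _ _ _ _ _ _ hpq
  · rw [chshS_eq, hR]
    have hs : π / 8 - θ / 2 + (-(π / 8) + θ / 2) = 0 := by ring
    have hd : π / 8 - θ / 2 - (-(π / 8) + θ / 2) = π / 4 - θ := by ring
    have ha : 2 * (π / 4) = π / 2 := by ring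
    simp only [hs, hd, ha, cos_sub, sin_sub, cos_pi_div_four, sin_pi_div_four, cos_zero, sin_zero,
      cos_pi_div_two, sin_pi_div_two, mul_zero]
    linear_combination R / 4 * √2 / 2 * hpq
end

section
/- Fix R ∈ (1/√2, 1] and θ ∈ [0, π/4 − arccos(1/(√2·R))], and let λ₀, λ₁, λ₂, λ₃ be given by the Bell-diagonal parameterization with δ = δ* = (R²·cos(2θ))/4. Then 1 + H_bin(λ₀ + λ₁) − H(λ₀, λ₁, λ₂, λ₃) ≥ 1 − H_bin(½·(1 + √(2R² − 1))), with equality when θ = π/4 − arccos(1/(√2·R)). -/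
open Real

/-- Binary entropy (base 2). -/
noncomputable def Hbin (p : ℝ) : ℝ := ent p + ent (1 - p)

noncomputable def lam0 (R θ δ : ℝ) : ℝ := 1 / 4 + R * Real.cos θ / 2 + δ
noncomputable def lam1 (R θ δ : ℝ) : ℝ := 1 / 4 + R * Real.sin θ / 2 - δ
noncomputable def lam2 (R θ δ : ℝ) : ℝ := 1 / 4 - R * Real.sin θ / 2 - δ
noncomputable def lam3 (R θ δ : ℝ) : ℝ := 1 / 4 - R * Real.cos θ / 2 + δ

/-- `δ* = R²·cos(2θ)/4`. -/
noncomputable def dstar (R θ : ℝ) : ℝ := R ^ 2 * Real.cos (2 * θ) / 4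

theorem ent_eq_negMulLog_div (x : ℝ) : ent x = negMulLog x / Real.log 2 := by
  simp only [ent, negMulLog, Real.logb]
  ring

theorem ent_mul (x y : ℝ) : ent (x * y) = y * ent x + x * ent y := by
  simp only [ent_eq_negMulLog_div, negMulLog_mul]
  ring

theorem Hbin_eq_binEntropy_div (p : ℝ) : Hbin p = binEntropy p / Real.log 2 := by
  rw [Hbin, ent_eq_negMulLog_div, ent_eq_negMulLog_div,
    binEntropy_eq_negMulLog_add_negMulLog_one_sub, add_div]

theorem Hbin_antitoneOn : AntitoneOn Hbin (Set.Icc (1 / 2) 1) := by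
  intro p hp q hq hpq
  rw [Hbin_eq_binEntropy_div, Hbin_eq_binEntropy_div]
  rw [one_div] at hp hq
  exact div_le_div_of_nonneg_right (binEntropy_strictAntiOn.antitoneOn hp hq hpq)
    (Real.log_nonneg one_le_two)

/-- Additivity of the entropy for the product of two binary distributions. -/
theorem H4_product (p q : ℝ) :
    H4 (p * q) (p * (1 - q)) ((1 - p) * q) ((1 - p) * (1 - q)) = Hbin p + Hbin q := by
  simp only [H4, Hbin, ent_mul]
  ring

/-- At `δ = δ*` the Bell-diagonal distribution is a product of two binary distributions. -/
theorem entropy_dstar (R θ : ℝ) :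
    1 + Hbin (lam0 R θ (dstar R θ) + lam1 R θ (dstar R θ)) -
        H4 (lam0 R θ (dstar R θ)) (lam1 R θ (dstar R θ))
           (lam2 R θ (dstar R θ)) (lam3 R θ (dstar R θ)) =
      1 - Hbin ((1 + (R * Real.cos θ - R * Real.sin θ)) / 2) := by
  have hd : dstar R θ = ((R * Real.cos θ) ^ 2 - (R * Real.sin θ) ^ 2) / 4 := by
    rw [dstar, Real.cos_two_mul']
    ring
  have h := H4_product ((1 + (R * Real.cos θ + R * Real.sin θ)) / 2)
    ((1 + (R * Real.cos θ - R * Real.sin θ)) / 2)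
  have h01 : lam0 R θ (dstar R θ) + lam1 R θ (dstar R θ) =
      (1 + (R * Real.cos θ + R * Real.sin θ)) / 2 := by
    simp only [lam0, lam1]
    ring
  rw [h01]
  simp only [lam0, lam1, lam2, lam3, hd]
  ring_nf at h ⊢
  linarith

theorem sqrt_two_mul_cos_sub_pi_div_four (θ : ℝ) :
    √2 * Real.cos (π / 4 - θ) = Real.cos θ + Real.sin θ := by
  rw [Real.cos_sub, Real.cos_pi_div_four, Real.sin_pi_div_four]
  linear_combination (Real.cos θ + Real.sin θ) / 2 * Real.sq_sqrt (zero_le_two (α := ℝ))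

/-- With `δ = δ*`, `1 + H_bin(λ₀+λ₁) − H(λ₀,λ₁,λ₂,λ₃) ≥ 1 − H_bin(½(1+√(2R²−1)))`,
with equality at `θ = π/4 − arccos(1/(√2 R))`. -/
theorem entropy_lower_bound_qubit (R θ : ℝ)
    (hR : 1 / Real.sqrt 2 < R) (hR1 : R ≤ 1)
    (hθ0 : 0 ≤ θ) (hθ1 : θ ≤ π / 4 - Real.arccos (1 / (Real.sqrt 2 * R))) :
    1 + Hbin (lam0 R θ (dstar R θ) + lam1 R θ (dstar R θ)) -
        H4 (lam0 R θ (dstar R θ)) (lam1 R θ (dstar R θ))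
           (lam2 R θ (dstar R θ)) (lam3 R θ (dstar R θ)) ≥
      1 - Hbin ((1 + Real.sqrt (2 * R ^ 2 - 1)) / 2) ∧
    (θ = π / 4 - Real.arccos (1 / (Real.sqrt 2 * R)) →
      1 + Hbin (lam0 R θ (dstar R θ) + lam1 R θ (dstar R θ)) -
          H4 (lam0 R θ (dstar R θ)) (lam1 R θ (dstar R θ))
             (lam2 R θ (dstar R θ)) (lam3 R θ (dstar R θ)) =
        1 - Hbin ((1 + Real.sqrt (2 * R ^ 2 - 1)) / 2)) := by
  rw [entropy_dstar]
  have h2 : 0 < √2 := by positivity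
  have hR0 : 0 < R := lt_trans (by positivity) hR
  have hpos : 0 < √2 * R := by positivity
  have hu1 : 1 / (√2 * R) ≤ 1 := by
    rw [div_lt_iff₀ h2] at hR
    rw [div_le_one hpos]
    linarith
  have hu0 : -1 ≤ 1 / (√2 * R) := le_trans (by norm_num) (one_div_pos.mpr hpos).le
  have hpi := Real.pi_pos
  have hac := Real.arccos_nonneg (1 / (√2 * R))
  have hcos := Real.cos_arccos hu0 hu1
  have hsum : R * Real.cos θ + R * Real.sin θ = √2 * R * Real.cos (π / 4 - θ) := by
    linear_combination -R * sqrt_two_mul_cos_sub_pi_div_four θ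
  have hsq : (R * Real.cos θ - R * Real.sin θ) ^ 2 =
      2 * R ^ 2 - (R * Real.cos θ + R * Real.sin θ) ^ 2 := by
    linear_combination 2 * R ^ 2 * Real.sin_sq_add_cos_sq θ
  have hs : 0 ≤ R * Real.sin θ :=
    mul_nonneg hR0.le (Real.sin_nonneg_of_nonneg_of_le_pi hθ0 (by linarith))
  have hdiff : 0 ≤ R * Real.cos θ - R * Real.sin θ := by
    have h : Real.sin θ ≤ Real.cos θ := by
      rw [← Real.cos_pi_div_two_sub]
      exact Real.cos_le_cos_of_nonneg_of_le_pi hθ0 (by linarith) (by linarith)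
    nlinarith
  have hle : R * Real.cos θ + R * Real.sin θ ≤ 1 := by
    rw [hsum, mul_comm, ← le_div_iff₀ hpos, ← hcos]
    exact Real.cos_le_cos_of_nonneg_of_le_pi hac (by linarith) (by linarith)
  constructor
  · have hsqrt : √(2 * R ^ 2 - 1) ≤ R * Real.cos θ - R * Real.sin θ :=
      Real.sqrt_le_iff.mpr ⟨hdiff, by nlinarith⟩
    have hsqrt0 := Real.sqrt_nonneg (2 * R ^ 2 - 1)
    have := Hbin_antitoneOn (a := (1 + √(2 * R ^ 2 - 1)) / 2)
      (b := (1 + (R * Real.cos θ - R * Real.sin θ)) / 2)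
      ⟨by linarith, by linarith⟩ ⟨by linarith, by linarith⟩ (by linarith)
    linarith
  · intro hθ
    have hone : R * Real.cos θ + R * Real.sin θ = 1 := by
      rw [hsum, hθ, sub_sub_cancel, hcos, mul_one_div_cancel hpos.ne']
    rw [hone, one_pow] at hsq
    rw [← hsq, Real.sqrt_sq hdiff]
end

section
/- The function K(R, θ) is monotonically nondecreasing in θ: for every R ∈ (1/√2, 1] and all θ₁, θ₂ with 0 ≤ θ₁ ≤ θ₂ ≤ π/4 − arccos(1/(√2·R)), one has K(R, θ₁) ≤ K(R, θ₂). -/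
open Real

/-- `K(R,θ) = 1 − H(λ₀,λ₁,λ₂,λ₃)` evaluated at `δ = δ*`. -/
noncomputable def Kfun (R θ : ℝ) : ℝ :=
  1 - H4 (lam0 R θ (dstar R θ)) (lam1 R θ (dstar R θ))
         (lam2 R θ (dstar R θ)) (lam3 R θ (dstar R θ))

/-- The function `x ↦ (log (1 + x) - log (1 - x)) / x = 2 artanh x / x` is monotone on `(0, 1)`. -/
lemma monotoneOn_log_sub_log_div :
    MonotoneOn (fun x : ℝ => (Real.log (1 + x) - Real.log (1 - x)) / x) (Set.Ioo 0 1) := by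
  have key : ∀ x ∈ Set.Ioo (0 : ℝ) 1,
      HasSum (fun k : ℕ => 2 * (1 / (2 * (k : ℝ) + 1)) * x ^ (2 * k))
        ((Real.log (1 + x) - Real.log (1 - x)) / x) := by
    intro x hx
    have hx0 : x ≠ 0 := hx.1.ne'
    have h := (Real.hasSum_log_sub_log_of_abs_lt_one
      (abs_lt.2 ⟨by linarith [hx.1], hx.2⟩)).div_const x
    refine h.congr_fun ?_
    intro k
    rw [pow_succ]
    field_simp
  intro x hx y hy hxy
  refine hasSum_le (fun k => ?_) (key x hx) (key y hy)
  have := hx.1.le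
  gcongr

/-- The binary entropy of a bit of bias `√t` is a concave function of `t`. -/
lemma concaveOn_binEntropy_sqrt :
    ConcaveOn ℝ (Set.Icc 0 1) (fun t : ℝ => Real.binEntropy ((1 + √t) / 2)) := by
  have hderiv : ∀ t ∈ Set.Ioo (0 : ℝ) 1,
      HasDerivAt (fun t : ℝ => Real.binEntropy ((1 + √t) / 2))
        (-((Real.log (1 + √t) - Real.log (1 - √t)) / √t) / 4) t := by
    intro t ht
    have h0 : 0 < √t := Real.sqrt_pos.2 ht.1
    have h1 : √t < 1 := by
      rw [Real.sqrt_lt' one_pos]; simpa using ht.2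
    have hs := ((Real.hasDerivAt_sqrt ht.1.ne').const_add 1).div_const 2
    have hb := Real.hasDerivAt_binEntropy (p := (1 + √t) / 2) (by linarith) (by linarith)
    refine (hb.comp t hs).congr_deriv ?_
    rw [show 1 - (1 + √t) / 2 = (1 - √t) / 2 by ring,
      Real.log_div (by linarith) two_ne_zero, Real.log_div (by linarith) two_ne_zero]
    field_simp
    ring
  refine AntitoneOn.concaveOn_of_deriv (convex_Icc 0 1) ?_ ?_ ?_
  · exact (Real.binEntropy_continuous.comp (by fun_prop)).continuousOn
  · rw [interior_Icc]
    exact fun t ht => (hderiv t ht).differentiableAt.differentiableWithinAt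
  · rw [interior_Icc]
    intro s hs t ht hst
    rw [(hderiv s hs).deriv, (hderiv t ht).deriv]
    have hmem : ∀ r ∈ Set.Ioo (0 : ℝ) 1, √r ∈ Set.Ioo (0 : ℝ) 1 := fun r hr =>
      ⟨Real.sqrt_pos.2 hr.1, by rw [Real.sqrt_lt' one_pos]; simpa using hr.2⟩
    have := monotoneOn_log_sub_log_div (hmem s hs) (hmem t ht) (Real.sqrt_le_sqrt hst)
    dsimp only at this
    linarith

/-- Spreading two points apart symmetrically decreases the sum of values of a concave function. -/
lemma ConcaveOn.add_sub_le_add_sub {f : ℝ → ℝ} {s : Set ℝ} (hf : ConcaveOn ℝ s f) {c d e : ℝ}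
    (hd : 0 ≤ d) (hde : d ≤ e) (h₁ : c + e ∈ s) (h₂ : c - e ∈ s) :
    f (c + e) + f (c - e) ≤ f (c + d) + f (c - d) := by
  rcases (hd.trans hde).eq_or_lt with rfl | he
  · rw [le_antisymm hde hd]
  have hw₁ : 0 ≤ (e + d) / (2 * e) := by positivity
  have hw₂ : 0 ≤ (e - d) / (2 * e) := div_nonneg (by linarith) (by positivity)
  have hw : (e + d) / (2 * e) + (e - d) / (2 * e) = 1 := by field_simp; ring
  have h := hf.2 h₁ h₂ hw₁ hw₂ hw
  have h' := hf.2 h₁ h₂ hw₂ hw₁ (by rw [add_comm, hw])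
  have hc : (e + d) / (2 * e) * (c + e) + (e - d) / (2 * e) * (c - e) = c + d := by
    field_simp; ring
  have hc' : (e - d) / (2 * e) * (c + e) + (e + d) / (2 * e) * (c - e) = c - d := by
    field_simp; ring
  simp only [smul_eq_mul, hc, hc'] at h h'
  linear_combination h + h' - hw * (f (c + e) + f (c - e))

/-- The entropy of a product of two binary distributions is the sum of their entropies. -/
lemma H4_mul (p q : ℝ) :
    H4 (p * q) (p * (1 - q)) ((1 - p) * q) ((1 - p) * (1 - q)) =
      (Real.binEntropy p + Real.binEntropy q) / Real.log 2 := by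
  have hent : ∀ x, ent x = Real.negMulLog x / Real.log 2 := fun x => by
    simp only [ent, Real.logb, Real.negMulLog]; ring
  simp only [H4, hent, Real.negMulLog_mul, Real.binEntropy_eq_negMulLog_add_negMulLog_one_sub]
  ring

lemma Kfun_eq {R θ : ℝ} (hR : 0 ≤ R) (hθ : 0 ≤ θ) (hθ' : θ ≤ π / 4) :
    Kfun R θ = 1 - (Real.binEntropy ((1 + √(R ^ 2 + R ^ 2 * Real.sin (2 * θ))) / 2) +
      Real.binEntropy ((1 + √(R ^ 2 - R ^ 2 * Real.sin (2 * θ))) / 2)) / Real.log 2 := by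
  have hsq := Real.sin_sq_add_cos_sq θ
  have hsin : 0 ≤ Real.sin θ := Real.sin_nonneg_of_nonneg_of_le_pi hθ (by linarith [Real.pi_pos])
  have hsc : Real.sin θ ≤ Real.cos θ := by
    rw [← Real.cos_pi_div_two_sub]
    exact Real.cos_le_cos_of_nonneg_of_le_pi hθ (by linarith) (by linarith)
  have hu : √(R ^ 2 + R ^ 2 * Real.sin (2 * θ)) = R * (Real.cos θ + Real.sin θ) := by
    rw [Real.sqrt_eq_iff_mul_self_eq (by nlinarith [Real.neg_one_le_sin (2 * θ)])
      (mul_nonneg hR (by linarith)), Real.sin_two_mul]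
    linear_combination -R ^ 2 * hsq
  have hv : √(R ^ 2 - R ^ 2 * Real.sin (2 * θ)) = R * (Real.cos θ - Real.sin θ) := by
    rw [Real.sqrt_eq_iff_mul_self_eq (by nlinarith [Real.sin_le_one (2 * θ)])
      (mul_nonneg hR (by linarith)), Real.sin_two_mul]
    linear_combination -R ^ 2 * hsq
  rw [hu, hv, ← H4_mul, Kfun, lam0, lam1, lam2, lam3, dstar, Real.cos_two_mul']
  congr 2 <;> ring

/-- `K(R,θ)` is monotonically nondecreasing in `θ`. -/
theorem Kfun_mono_theta (R θ₁ θ₂ : ℝ)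
    (hR : 1 / Real.sqrt 2 < R) (hR1 : R ≤ 1)
    (hθ₁ : 0 ≤ θ₁) (hθ : θ₁ ≤ θ₂)
    (hθ₂ : θ₂ ≤ π / 4 - Real.arccos (1 / (Real.sqrt 2 * R))) :
    Kfun R θ₁ ≤ Kfun R θ₂ := by
  have hpi := Real.pi_pos
  have h2 : 0 < √(2 : ℝ) := by positivity
  have hR0 : 0 < R := lt_trans (by positivity) hR
  have hRs : 1 < √2 * R := by rwa [div_lt_iff₀' h2] at hR
  have hac := Real.arccos_nonneg (1 / (√2 * R))
  have hle : R * (Real.cos θ₂ + Real.sin θ₂) ≤ 1 := by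
    have hcos : Real.cos (π / 4 - θ₂) ≤ 1 / (√2 * R) := by
      rw [← Real.cos_arccos (x := 1 / (√2 * R)) (by linarith [show 0 < 1 / (√2 * R) by positivity])
        ((div_le_one (by positivity)).2 hRs.le)]
      exact Real.cos_le_cos_of_nonneg_of_le_pi hac (by linarith) (by linarith)
    rw [le_div_iff₀ (by positivity), Real.cos_sub, Real.cos_pi_div_four,
      Real.sin_pi_div_four] at hcos
    nlinarith [Real.mul_self_sqrt (show (0 : ℝ) ≤ 2 by norm_num)]
  have hsin : 0 ≤ Real.sin (2 * θ₁) :=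
    Real.sin_nonneg_of_nonneg_of_le_pi (by linarith) (by linarith)
  have hsin' : Real.sin (2 * θ₁) ≤ Real.sin (2 * θ₂) :=
    Real.sin_le_sin_of_le_of_le_pi_div_two (by linarith) (by linarith) (by linarith)
  have hRe : 0 ≤ R ^ 2 * Real.sin (2 * θ₂) := mul_nonneg (sq_nonneg R) (hsin.trans hsin')
  have hlow : 0 ≤ R ^ 2 - R ^ 2 * Real.sin (2 * θ₂) := by
    nlinarith [Real.sin_le_one (2 * θ₂), sq_nonneg R]
  have hupp : R ^ 2 + R ^ 2 * Real.sin (2 * θ₂) ≤ 1 := by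
    have hnn : 0 ≤ R * (Real.cos θ₂ + Real.sin θ₂) :=
      mul_nonneg hR0.le (add_nonneg (Real.cos_nonneg_of_mem_Icc ⟨by linarith, by linarith⟩)
        (Real.sin_nonneg_of_nonneg_of_le_pi (by linarith) (by linarith)))
    have hsq := pow_le_one₀ (n := 2) hnn hle
    rw [Real.sin_two_mul]
    linear_combination hsq - R ^ 2 * Real.sin_sq_add_cos_sq θ₂
  rw [Kfun_eq hR0.le hθ₁ (by linarith), Kfun_eq hR0.le (hθ₁.trans hθ) (by linarith)]
  refine sub_le_sub_left (div_le_div_of_nonneg_right ?_ (Real.log_nonneg one_le_two)) 1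
  exact concaveOn_binEntropy_sqrt.add_sub_le_add_sub (mul_nonneg (sq_nonneg R) hsin)
    (mul_le_mul_of_nonneg_left hsin' (sq_nonneg R))
    ⟨by positivity, hupp⟩ ⟨hlow, by linarith⟩
end

section
/- For every θ ∈ ℝ and every (α₀, α₁, β₀, β₁) ∈ ℝ⁴ there exist (α₀′, α₁′, β₀′, β₁′) ∈ ℝ⁴ such that ε̂_{ij}(θ, α₀′, α₁′, β₀′, β₁′) = ε̂_{ij}(θ, α₀, α₁, β₀, β₁) for all i, j ∈ {0,1}, and moreover sin(β₀′ + β₁′) ≥ 0 and sin(β₀′ − β₁′) ≤ 0. -/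
open Real

noncomputable def ehat00 (θ a0 a1 b0 b1 : ℝ) : ℝ :=
  Real.cos θ * Real.cos (2 * a0 - 2 * b0) + Real.sin θ * Real.cos (2 * a0 + 2 * b0)

noncomputable def ehat01 (θ a0 a1 b0 b1 : ℝ) : ℝ :=
  Real.cos θ * Real.cos (2 * a0 - 2 * b1) + Real.sin θ * Real.cos (2 * a0 + 2 * b1)

noncomputable def ehat10 (θ a0 a1 b0 b1 : ℝ) : ℝ :=
  Real.cos θ * Real.cos (2 * a1 - 2 * b0) + Real.sin θ * Real.cos (2 * a1 + 2 * b0)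

noncomputable def ehat11 (θ a0 a1 b0 b1 : ℝ) : ℝ :=
  -(Real.cos θ * Real.cos (2 * a1 - 2 * b1)) - Real.sin θ * Real.cos (2 * a1 + 2 * b1)

/-- Adding `π / 2` to all four angles if necessary, one can make `sin (β₀ + β₁)` nonnegative without
changing any `ε̂_{ij}` or `sin (β₀ - β₁)`. -/
theorem exists_angles_sin_add_nonneg (θ a0 a1 b0 b1 : ℝ) :
    ∃ a0' a1' b0' b1' : ℝ,
      ehat00 θ a0' a1' b0' b1' = ehat00 θ a0 a1 b0 b1 ∧
      ehat01 θ a0' a1' b0' b1' = ehat01 θ a0 a1 b0 b1 ∧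
      ehat10 θ a0' a1' b0' b1' = ehat10 θ a0 a1 b0 b1 ∧
      ehat11 θ a0' a1' b0' b1' = ehat11 θ a0 a1 b0 b1 ∧
      0 ≤ Real.sin (b0' + b1') ∧ Real.sin (b0' - b1') = Real.sin (b0 - b1) := by
  rcases le_total 0 (Real.sin (b0 + b1)) with h | h
  · exact ⟨a0, a1, b0, b1, rfl, rfl, rfl, rfl, h, rfl⟩
  have cos_sub_shift (a b : ℝ) :
      Real.cos (2 * (a + π / 2) - 2 * (b + π / 2)) = Real.cos (2 * a - 2 * b) := by
    congr 1; ring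
  have cos_add_shift (a b : ℝ) :
      Real.cos (2 * (a + π / 2) + 2 * (b + π / 2)) = Real.cos (2 * a + 2 * b) := by
    rw [← Real.cos_add_two_pi (2 * a + 2 * b)]; congr 1; ring
  refine ⟨a0 + π / 2, a1 + π / 2, b0 + π / 2, b1 + π / 2, ?_, ?_, ?_, ?_, ?_, ?_⟩
  · simp only [ehat00, cos_sub_shift, cos_add_shift]
  · simp only [ehat01, cos_sub_shift, cos_add_shift]
  · simp only [ehat10, cos_sub_shift, cos_add_shift]
  · simp only [ehat11, cos_sub_shift, cos_add_shift]
  · rw [show b0 + π / 2 + (b1 + π / 2) = b0 + b1 + π by ring, Real.sin_add_pi]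
    linarith
  · congr 1; ring

/-- Every choice of angles can be replaced by one with the same values of all
`ε̂_{ij}` and with `sin(β₀'+β₁') ≥ 0` and `sin(β₀'−β₁') ≤ 0`. -/
theorem angles_normal_form (θ a0 a1 b0 b1 : ℝ) :
    ∃ a0' a1' b0' b1' : ℝ,
      ehat00 θ a0' a1' b0' b1' = ehat00 θ a0 a1 b0 b1 ∧
      ehat01 θ a0' a1' b0' b1' = ehat01 θ a0 a1 b0 b1 ∧
      ehat10 θ a0' a1' b0' b1' = ehat10 θ a0 a1 b0 b1 ∧
      ehat11 θ a0' a1' b0' b1' = ehat11 θ a0 a1 b0 b1 ∧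
      0 ≤ Real.sin (b0' + b1') ∧ Real.sin (b0' - b1') ≤ 0 := by
  rcases le_total (Real.sin (b0 - b1)) 0 with h | h
  · obtain ⟨a0', a1', b0', b1', h00, h01, h10, h11, hadd, hsub⟩ :=
      exists_angles_sin_add_nonneg θ a0 a1 b0 b1
    exact ⟨a0', a1', b0', b1', h00, h01, h10, h11, hadd, hsub.trans_le h⟩
  have cos_sub_shift (a : ℝ) : Real.cos (2 * a - 2 * (b0 + π)) = Real.cos (2 * a - 2 * b0) := by
    rw [← Real.cos_sub_two_pi (2 * a - 2 * b0)]; congr 1; ring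
  have cos_add_shift (a : ℝ) : Real.cos (2 * a + 2 * (b0 + π)) = Real.cos (2 * a + 2 * b0) := by
    rw [← Real.cos_add_two_pi (2 * a + 2 * b0)]; congr 1; ring
  obtain ⟨a0', a1', b0', b1', h00, h01, h10, h11, hadd, hsub⟩ :=
    exists_angles_sin_add_nonneg θ a0 a1 (b0 + π) b1
  refine ⟨a0', a1', b0', b1', h00.trans ?_, h01, h10.trans ?_, h11, hadd, ?_⟩
  · simp only [ehat00, cos_sub_shift, cos_add_shift]
  · simp only [ehat10, cos_sub_shift, cos_add_shift]
  · rw [hsub, show b0 + π - b1 = b0 - b1 + π by ring, Real.sin_add_pi]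
    linarith
end

section
/- Let λ₀′, λ₁′, λ₂′, λ₃′, r₁, r₂ be real numbers and let ρ be the operator on ℂ² ⊗ ℂ² given in the Bell basis by ρ = ∑ᵢ λᵢ′·|Φᵢ⟩⟨Φᵢ| + r₁·(|Φ₀⟩⟨Φ₃| + |Φ₃⟩⟨Φ₀|) + r₂·(|Φ₁⟩⟨Φ₂| + |Φ₂⟩⟨Φ₁|). For θ ∈ ℝ, let U_θ be the single-qubit operator with matrix [[cos(θ/2), sin(θ/2)], [−sin(θ/2), cos(θ/2)]] in the computational basis. Then there exist θ_A, θ_B ∈ ℝ and real numbers μ₀, μ₁, μ₂, μ₃ such that (U_{θ_A} ⊗ U_{θ_B}) ρ (U_{θ_A} ⊗ U_{θ_B})† = ∑ᵢ μᵢ·|Φᵢ⟩⟨Φᵢ|, i.e. the conjugated operator is diagonal in the Bell basis. -/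
open Matrix Kronecker

/-- The Bell basis of `ℂ² ⊗ ℂ²` (indexed by `Fin 4`), as vectors on
`Fin 2 × Fin 2`. -/
noncomputable def bell : Fin 4 → (Fin 2 × Fin 2) → ℂ
  | 0 => fun p => if p = (0, 0) then (Real.sqrt 2 : ℂ)⁻¹
                  else if p = (1, 1) then (Real.sqrt 2 : ℂ)⁻¹ else 0
  | 1 => fun p => if p = (0, 0) then (Real.sqrt 2 : ℂ)⁻¹
                  else if p = (1, 1) then -(Real.sqrt 2 : ℂ)⁻¹ else 0
  | 2 => fun p => if p = (0, 1) then (Real.sqrt 2 : ℂ)⁻¹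
                  else if p = (1, 0) then (Real.sqrt 2 : ℂ)⁻¹ else 0
  | 3 => fun p => if p = (0, 1) then (Real.sqrt 2 : ℂ)⁻¹
                  else if p = (1, 0) then -(Real.sqrt 2 : ℂ)⁻¹ else 0

/-- Outer product `|u⟩⟨v|`. -/
noncomputable def outer (u v : Fin 2 × Fin 2 → ℂ) :
    Matrix (Fin 2 × Fin 2) (Fin 2 × Fin 2) ℂ :=
  Matrix.of fun p q => u p * star (v q)

/-- The single-qubit rotation `U_θ`. -/
noncomputable def Uq (θ : ℝ) : Matrix (Fin 2) (Fin 2) ℂ :=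
  !![(Real.cos (θ / 2) : ℂ), (Real.sin (θ / 2) : ℂ);
     (-(Real.sin (θ / 2)) : ℂ), (Real.cos (θ / 2) : ℂ)]

theorem mul_outer_mul_conjTranspose (U : Matrix (Fin 2 × Fin 2) (Fin 2 × Fin 2) ℂ)
    (u v : Fin 2 × Fin 2 → ℂ) : U * outer u v * Uᴴ = outer (U *ᵥ u) (U *ᵥ v) := by
  have h (a b : Fin 2 × Fin 2 → ℂ) : outer a b = vecMulVec a (star b) := rfl
  rw [h, h, mul_vecMulVec, vecMulVec_mul, star_mulVec]

/-- A real symmetric quadratic form in two variables is diagonalized by a rotation. -/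
theorem exists_angle_offDiag_eq_zero (x y r : ℝ) :
    ∃ φ : ℝ, (x - y) * (Real.cos φ * Real.sin φ) + r * (Real.cos φ ^ 2 - Real.sin φ ^ 2) = 0 := by
  set z : ℂ := ⟨(x - y) / 2, -r⟩
  have hc : ‖z‖ * Real.cos z.arg = (x - y) / 2 := Complex.norm_mul_cos_arg z
  have hs : ‖z‖ * Real.sin z.arg = -r := Complex.norm_mul_sin_arg z
  refine ⟨z.arg / 2, ?_⟩
  have h2 : z.arg = 2 * (z.arg / 2) := by ring
  have hsin := Real.sin_two_mul (z.arg / 2)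
  have hcos := Real.cos_two_mul' (z.arg / 2)
  rw [← h2] at hsin hcos
  linear_combination (-(x - y) / 2) * hsin - r * hcos - Real.sin z.arg * hc + Real.cos z.arg * hs

theorem outer_rotation_diagonal (u v : Fin 2 × Fin 2 → ℂ) (x y r φ : ℝ)
    (h : (x - y) * (Real.cos φ * Real.sin φ) + r * (Real.cos φ ^ 2 - Real.sin φ ^ 2) = 0)
    {u' v' : Fin 2 × Fin 2 → ℂ}
    (hu : u' = (Real.cos φ : ℂ) • u + (Real.sin φ : ℂ) • v)
    (hv : v' = (Real.cos φ : ℂ) • v - (Real.sin φ : ℂ) • u) :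
    ∃ μ ν : ℝ,
      (x : ℂ) • outer u' u' + (y : ℂ) • outer v' v' + (r : ℂ) • (outer u' v' + outer v' u') =
        (μ : ℂ) • outer u u + (ν : ℂ) • outer v v := by
  subst hu hv
  generalize Real.cos φ = c at *
  generalize Real.sin φ = s at *
  have hC : ((x : ℂ) - y) * (c * s) + r * (c ^ 2 - s ^ 2) = 0 := by exact_mod_cast h
  refine ⟨x * c ^ 2 + y * s ^ 2 - 2 * r * (c * s), x * s ^ 2 + y * c ^ 2 + 2 * r * (c * s), ?_⟩
  ext p q
  simp only [outer, Matrix.add_apply, Matrix.smul_apply, Matrix.of_apply, Pi.add_apply,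
    Pi.sub_apply, Pi.smul_apply, smul_eq_mul, star_add, star_sub, star_mul', Complex.star_def,
    Complex.conj_ofReal]
  push_cast
  linear_combination (u p * (starRingEnd ℂ) (v q) + v p * (starRingEnd ℂ) (u q)) * hC

theorem Uq_kronecker_mulVec_bell (φ ψ : ℝ) :
    (Uq (φ + ψ) ⊗ₖ Uq (ψ - φ)) *ᵥ bell 0 =
        (Real.cos φ : ℂ) • bell 0 + (Real.sin φ : ℂ) • bell 3 ∧
      (Uq (φ + ψ) ⊗ₖ Uq (ψ - φ)) *ᵥ bell 3 =
        (Real.cos φ : ℂ) • bell 3 - (Real.sin φ : ℂ) • bell 0 ∧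
      (Uq (φ + ψ) ⊗ₖ Uq (ψ - φ)) *ᵥ bell 2 =
        (Real.cos ψ : ℂ) • bell 2 + (Real.sin ψ : ℂ) • bell 1 ∧
      (Uq (φ + ψ) ⊗ₖ Uq (ψ - φ)) *ᵥ bell 1 =
        (Real.cos ψ : ℂ) • bell 1 - (Real.sin ψ : ℂ) • bell 2 := by
  have hφ : φ = (φ + ψ) / 2 - (ψ - φ) / 2 := by ring
  have hψ : ψ = (φ + ψ) / 2 + (ψ - φ) / 2 := by ring
  have h1 := congrArg Real.cos hφ
  have h2 := congrArg Real.sin hφ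
  have h3 := congrArg Real.cos hψ
  have h4 := congrArg Real.sin hψ
  rw [Real.cos_sub] at h1
  rw [Real.sin_sub] at h2
  rw [Real.cos_add] at h3
  rw [Real.sin_add] at h4
  rw [h1, h2, h3, h4]
  refine ⟨?_, ?_, ?_, ?_⟩ <;> ext ⟨i, j⟩ <;> fin_cases i <;> fin_cases j <;>
    simp [Matrix.mulVec, dotProduct, Fintype.sum_prod_type, Uq, bell, -Complex.ofReal_cos,
      -Complex.ofReal_sin] <;> ring

/-- Any Bell-basis operator of the form
`∑ᵢ λᵢ'|Φᵢ⟩⟨Φᵢ| + r₁(|Φ₀⟩⟨Φ₃|+|Φ₃⟩⟨Φ₀|) + r₂(|Φ₁⟩⟨Φ₂|+|Φ₂⟩⟨Φ₁|)` with real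
coefficients can be diagonalized in the Bell basis by a conjugation
`(U_{θ_A} ⊗ U_{θ_B}) · (U_{θ_A} ⊗ U_{θ_B})†`. -/
theorem bell_diagonalization (l0 l1 l2 l3 r1 r2 : ℝ) :
    ∃ θA θB μ0 μ1 μ2 μ3 : ℝ,
      (Uq θA ⊗ₖ Uq θB) *
        ((l0 : ℂ) • outer (bell 0) (bell 0) + (l1 : ℂ) • outer (bell 1) (bell 1) +
         (l2 : ℂ) • outer (bell 2) (bell 2) + (l3 : ℂ) • outer (bell 3) (bell 3) +
         (r1 : ℂ) • (outer (bell 0) (bell 3) + outer (bell 3) (bell 0)) +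
         (r2 : ℂ) • (outer (bell 1) (bell 2) + outer (bell 2) (bell 1))) *
        (Uq θA ⊗ₖ Uq θB)ᴴ =
      (μ0 : ℂ) • outer (bell 0) (bell 0) + (μ1 : ℂ) • outer (bell 1) (bell 1) +
      (μ2 : ℂ) • outer (bell 2) (bell 2) + (μ3 : ℂ) • outer (bell 3) (bell 3) := by
  obtain ⟨φ, hφ⟩ := exists_angle_offDiag_eq_zero l0 l3 r1
  obtain ⟨ψ, hψ⟩ := exists_angle_offDiag_eq_zero l2 l1 r2
  obtain ⟨h0, h3, h2, h1⟩ := Uq_kronecker_mulVec_bell φ ψ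
  obtain ⟨μ0, μ3, hA⟩ := outer_rotation_diagonal (bell 0) (bell 3) l0 l3 r1 φ hφ h0 h3
  obtain ⟨μ2, μ1, hB⟩ := outer_rotation_diagonal (bell 2) (bell 1) l2 l1 r2 ψ hψ h2 h1
  refine ⟨φ + ψ, ψ - φ, μ0, μ1, μ2, μ3, ?_⟩
  simp only [Matrix.mul_add, Matrix.add_mul, Matrix.mul_smul, Matrix.smul_mul,
    mul_outer_mul_conjTranspose]
  refine Eq.trans ?_ ((congrArg₂ (· + ·) hA hB).trans ?_)
  · simp only [smul_add]
    abel
  · abel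
end
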